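/- arXiv:2510.08862 — 2 statements merged into one kernel-verified Lean document; each statement's English description precedes it below -/
import Mathlib

section
/- For each ε ∈ (0, 1/2) there is a threshold N₀(ε) such that the following holds. Let N > N₀(ε) be an integer and let y be a real number with (16·log N)^{1/(1/2+ε)} ≤ y ≤ N. For each prime p ∈ [y, 2y], let R_p ⊆ ℤ/pℤ be the image mod p of the integer interval {0, 1, …, ⌊p^{1/2−ε}⌋}. Let A be the set of all integers n ∈ {0, 1, …, N} such that for every prime p ∈ [y, 2y] the residue of n mod p lies in R_p, and let q be the smallest prime in [y, 2y]. Then A = {n ∈ ℤ : 0 ≤ n ≤ q^{1/2−ε}}. -/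
open Finset in
/-- The product of the primes in `(n, 2n]` bounds the central binomial coefficient up to
the contribution of the primes at most `2n/3`. -/
theorem centralBinom_le_mul_prod_primes {n : ℕ} (hn : 2 < n) :
    n.centralBinom ≤ (2 * n) ^ Nat.sqrt (2 * n) * 4 ^ (2 * n / 3) *
      ∏ p ∈ (Ioc n (2 * n)).filter Nat.Prime, p := by
  let S := (range (2 * n + 1)).filter Nat.Prime
  let f : ℕ → ℕ := fun p => p ^ n.centralBinom.factorization p
  have hS : ∏ p ∈ S, f p = n.centralBinom := by
    rw [← n.prod_pow_factorization_centralBinom]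
    refine prod_filter_of_ne fun p _ h => ?_
    contrapose h
    dsimp only [f]
    rw [Nat.factorization_eq_zero_of_not_prime n.centralBinom h, pow_zero]
  have hf : ∀ p ∈ S, f p ≤ (if p ≤ Nat.sqrt (2 * n) then 2 * n else 1) *
      (if p ≤ 2 * n / 3 then p else 1) * (if n < p then p else 1) := by
    intro p hp
    have hpp : p.Prime := (mem_filter.1 hp).2
    have h2 : 1 ≤ if p ≤ 2 * n / 3 then p else 1 := by split_ifs <;> linarith [hpp.one_lt]
    have h3 : 1 ≤ if n < p then p else 1 := by split_ifs <;> linarith [hpp.one_lt]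
    by_cases h : p ≤ Nat.sqrt (2 * n)
    · have : f p ≤ 2 * n := Nat.pow_factorization_choose_le (by omega)
      rw [if_pos h]
      calc f p ≤ 2 * n * 1 * 1 := by omega
        _ ≤ _ := by gcongr
    · have hle : f p ≤ p :=
        (pow_right_mono₀ hpp.one_lt.le (Nat.factorization_choose_le_one
          (Nat.sqrt_lt'.mp (not_le.1 h)))).trans (pow_one p).le
      rw [if_neg h]
      by_cases ha : p ≤ 2 * n / 3
      · rw [if_pos ha]
        calc f p ≤ 1 * p * 1 := by omega
          _ ≤ _ := by gcongr
      · rw [if_neg ha]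
        by_cases hb : n < p
        · rw [if_pos hb]; omega
        · have : f p = 1 := by
            dsimp only [f]
            rw [Nat.factorization_centralBinom_of_two_mul_self_lt_three_mul hn (by omega)
              (by omega), pow_zero]
          rw [if_neg hb, this]
  rw [← hS]
  refine (prod_le_prod' hf).trans ?_
  rw [prod_mul_distrib, prod_mul_distrib, ← prod_filter, ← prod_filter, ← prod_filter]
  refine Nat.mul_le_mul (Nat.mul_le_mul ?_ ?_) (le_of_eq ?_)
  · rw [prod_const]
    refine Nat.pow_le_pow_right (by omega) ?_
    have : #(Icc 1 (Nat.sqrt (2 * n))) = Nat.sqrt (2 * n) := by simp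
    refine (card_le_card fun p hp => ?_).trans this.le
    obtain ⟨h1, h2⟩ := mem_filter.1 hp
    exact mem_Icc.2 ⟨(mem_filter.1 h1).2.one_lt.le, h2⟩
  · refine le_trans ?_ (primorial_le_four_pow (2 * n / 3))
    refine prod_le_prod_of_subset_of_one_le' (fun p hp => ?_) fun p hp _ => ?_
    · simp only [S, mem_filter, mem_range] at hp ⊢
      exact ⟨by omega, hp.1.2⟩
    · exact (mem_filter.1 hp).2.one_lt.le
  · refine prod_congr ?_ fun _ _ => rfl
    ext p
    simp only [S, mem_filter, mem_range, mem_Ioc]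
    constructor
    · rintro ⟨⟨h1, h2⟩, h3⟩; exact ⟨⟨h3, by omega⟩, h2⟩
    · rintro ⟨⟨h1, h2⟩, h3⟩; exact ⟨⟨by omega, h3⟩, h1⟩

/-- A Chebyshev-type lower bound for the product of the primes in `(n, 2n]`. -/
theorem eventually_div_four_le_log_prod_primes : ∀ᶠ n : ℕ in Filter.atTop,
    (n : ℝ) / 4 ≤ Real.log (∏ p ∈ (Finset.Ioc n (2 * n)).filter Nat.Prime, p : ℕ) := by
  have hlog : ∀ᶠ x : ℝ in Filter.atTop, Real.log x ≤ 1 / 20 * x ^ (1 / 2 : ℝ) := by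
    filter_upwards [(isLittleO_log_rpow_atTop (r := 1 / 2) (by norm_num)).bound
      (show (0 : ℝ) < 1 / 20 by norm_num), Filter.eventually_ge_atTop 0] with x hx h0
    rw [Real.norm_eq_abs, Real.norm_eq_abs, abs_of_nonneg (Real.rpow_nonneg h0 _)] at hx
    exact (le_abs_self _).trans hx
  have htend : Filter.Tendsto (fun n : ℕ => 2 * (n : ℝ)) Filter.atTop Filter.atTop :=
    tendsto_natCast_atTop_atTop.const_mul_atTop (by norm_num)
  filter_upwards [htend.eventually hlog, Filter.eventually_ge_atTop 4] with n hn h4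
  set P := ∏ p ∈ (Finset.Ioc n (2 * n)).filter Nat.Prime, p with hP
  have hP0 : 0 < P := Finset.prod_pos fun p hp => (Finset.mem_filter.1 hp).2.pos
  have hPr : (0 : ℝ) < P := by exact_mod_cast hP0
  have h4r : (4 : ℝ) ≤ n := by exact_mod_cast h4
  have hmain : 4 ^ n ≤ n * ((2 * n) ^ Nat.sqrt (2 * n) * 4 ^ (2 * n / 3) * P) :=
    (Nat.four_pow_lt_mul_centralBinom n h4).le.trans
      (Nat.mul_le_mul_left _ (centralBinom_le_mul_prod_primes (by omega)))
  have hmain' : (4 : ℝ) ^ n ≤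
      n * ((2 * n) ^ Nat.sqrt (2 * n) * 4 ^ (2 * n / 3) * P) := by exact_mod_cast hmain
  have hl := Real.log_le_log (by positivity) hmain'
  rw [Real.log_mul (by positivity) (by positivity), Real.log_mul (by positivity) (by positivity),
    Real.log_mul (by positivity) (by positivity), Real.log_pow, Real.log_pow, Real.log_pow] at hl
  rw [← Real.sqrt_eq_rpow] at hn
  have hs : (Nat.sqrt (2 * n) : ℝ) ≤ √(2 * n) := by
    have := Real.nat_sqrt_le_real_sqrt (a := 2 * n)
    push_cast at this
    exact this
  have hss : √(2 * (n : ℝ)) * √(2 * n) = 2 * n := Real.mul_self_sqrt (by positivity)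
  have hs1 : 1 ≤ √(2 * (n : ℝ)) := Real.one_le_sqrt.2 (by linarith)
  have hlog0 : 0 ≤ Real.log (2 * (n : ℝ)) := Real.log_nonneg (by linarith)
  have hA : (Nat.sqrt (2 * n) : ℝ) * Real.log (2 * n) ≤ n / 10 := by
    calc (Nat.sqrt (2 * n) : ℝ) * Real.log (2 * n) ≤ √(2 * n) * (1 / 20 * √(2 * n)) := by gcongr
      _ = n / 10 := by linarith
  have hB : Real.log n ≤ n / 10 := by
    have : Real.log n ≤ Real.log (2 * n) := Real.log_le_log (by positivity) (by linarith)
    nlinarith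
  have hC : ((2 * n / 3 : ℕ) : ℝ) ≤ 2 * n / 3 := by
    have := Nat.cast_div_le (α := ℝ) (m := 2 * n) (n := 3)
    push_cast at this
    exact this
  have hlog4 : Real.log 4 = 2 * Real.log 2 := by
    rw [show (4 : ℝ) = 2 ^ 2 by norm_num, Real.log_pow]; norm_num
  have hl2 := Real.log_two_gt_d9
  have hD : ((2 * n / 3 : ℕ) : ℝ) * Real.log 4 ≤ 2 * n / 3 * Real.log 4 := by gcongr
  rw [hlog4] at hl hD
  nlinarith

/-- If `a > J` is congruent to an element of `[0, J]` modulo each prime in a finite set, then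
the product of these primes is at most `a ^ (J + 1)`. -/
theorem prod_primes_le_pow_of_residues {s : Finset ℕ} (hs : ∀ p ∈ s, p.Prime) {a J : ℕ}
    (ha : J < a) (h : ∀ p ∈ s, ∃ j ≤ J, (a : ZMod p) = j) :
    ∏ p ∈ s, p ≤ a ^ (J + 1) := by
  refine (Nat.le_of_dvd (Nat.descFactorial_pos.2 (by omega)) ?_).trans
    (Nat.descFactorial_le_pow a (J + 1))
  refine Finset.prod_primes_dvd _ (fun p hp => (hs p hp).prime) fun p hp => ?_
  obtain ⟨j, hj, hja⟩ := h p hp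
  rw [Nat.descFactorial_eq_prod_range]
  refine dvd_trans ?_ (Finset.dvd_prod_of_mem _ (Finset.mem_range.2 (Nat.lt_succ_of_le hj)))
  exact (Nat.modEq_iff_dvd' (by omega)).1 ((ZMod.natCast_eq_natCast_iff _ _ _).1 hja.symm)

/-- An integer `a ≤ N` whose residue modulo every prime `p ∈ [y, 2y]` is at most
`p ^ (1/2 - ε)` is itself at most `(2y) ^ (1/2 - ε)`, once `y` is large and
`16 log N ≤ y ^ (1/2 + ε)`. -/
theorem le_rpow_of_small_residues {ε : ℝ} (hε : ε ∈ Set.Ioo (0 : ℝ) (1 / 2)) {N : ℕ} {y : ℝ}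
    (hy : 4 ≤ y) (hN : 16 * Real.log N ≤ y ^ (1 / 2 + ε))
    (hP : (⌊y⌋₊ : ℝ) / 4 ≤
      Real.log (∏ p ∈ (Finset.Ioc ⌊y⌋₊ (2 * ⌊y⌋₊)).filter Nat.Prime, p : ℕ))
    {a : ℕ} (haN : a ≤ N)
    (h : ∀ p : ℕ, p.Prime → y ≤ p → (p : ℝ) ≤ 2 * y →
      ∃ j : ℕ, (j : ℝ) ≤ (p : ℝ) ^ (1 / 2 - ε) ∧ (a : ZMod p) = j) :
    (a : ℝ) ≤ (2 * y) ^ (1 / 2 - ε) := by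
  obtain ⟨hε0, hε1⟩ := hε
  set J := ⌊(2 * y) ^ (1 / 2 - ε)⌋₊ with hJ
  have hJle : (J : ℝ) ≤ (2 * y) ^ (1 / 2 - ε) := Nat.floor_le (by positivity)
  suffices a ≤ J from le_trans (by exact_mod_cast this) hJle
  by_contra! ha
  set n := ⌊y⌋₊ with hn
  have hny : (n : ℝ) ≤ y := Nat.floor_le (by linarith)
  have hyn : y < n + 1 := Nat.lt_floor_add_one y
  have hprod := prod_primes_le_pow_of_residues
    (s := (Finset.Ioc n (2 * n)).filter Nat.Prime) (fun p hp => (Finset.mem_filter.1 hp).2) ha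
    (fun p hp => by
      obtain ⟨h1, hpp⟩ := Finset.mem_filter.1 hp
      obtain ⟨h1, h2⟩ := Finset.mem_Ioc.1 h1
      have h1' : (n : ℝ) + 1 ≤ p := by exact_mod_cast h1
      have h2' : (p : ℝ) ≤ 2 * n := by exact_mod_cast h2
      obtain ⟨j, hj, hja⟩ := h p hpp (by linarith) (by linarith)
      refine ⟨j, Nat.le_floor (hj.trans ?_), hja⟩
      exact Real.rpow_le_rpow (by positivity) (by linarith) (by linarith))
  have hpos : 0 < ∏ p ∈ (Finset.Ioc n (2 * n)).filter Nat.Prime, p :=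
    Finset.prod_pos fun p hp => (Finset.mem_filter.1 hp).2.pos
  have hprodN : (∏ p ∈ (Finset.Ioc n (2 * n)).filter Nat.Prime, p : ℕ) ≤ N ^ (J + 1) :=
    hprod.trans (Nat.pow_le_pow_left haN _)
  have hprod' : ((∏ p ∈ (Finset.Ioc n (2 * n)).filter Nat.Prime, p : ℕ) : ℝ) ≤
      (N : ℝ) ^ (J + 1) := by exact_mod_cast hprodN
  have hlog := Real.log_le_log (by exact_mod_cast hpos) hprod'
  rw [Real.log_pow] at hlog
  push_cast at hlog hP
  have hmul : (2 * y) ^ (1 / 2 - ε) * y ^ (1 / 2 + ε) ≤ 2 * y := by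
    calc (2 * y) ^ (1 / 2 - ε) * y ^ (1 / 2 + ε)
        ≤ (2 * y) ^ (1 / 2 - ε) * (2 * y) ^ (1 / 2 + ε) := by
          gcongr; linarith
      _ = 2 * y := by
          rw [← Real.rpow_add (by linarith), show 1 / 2 - ε + (1 / 2 + ε) = 1 by ring,
            Real.rpow_one]
  have hone : y ^ (1 / 2 + ε) ≤ y :=
    (Real.rpow_le_rpow_of_exponent_le (by linarith) (by linarith)).trans (Real.rpow_one y).le
  have hlogN : ((J : ℝ) + 1) * (16 * Real.log N) ≤ 3 * y := by
    calc ((J : ℝ) + 1) * (16 * Real.log N)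
        ≤ ((2 * y) ^ (1 / 2 - ε) + 1) * y ^ (1 / 2 + ε) := by gcongr
      _ ≤ 3 * y := by linarith
  linarith

theorem stmt16 :
    ∀ ε : ℝ, ε ∈ Set.Ioo (0 : ℝ) (1/2) → ∃ N₀ : ℕ,
      ∀ N : ℕ, N₀ < N → ∀ y : ℝ,
        (16 * Real.log N) ^ (1 / ((1 : ℝ)/2 + ε)) ≤ y → y ≤ N →
        ∀ A : Set ℤ,
          A = {n : ℤ | 0 ≤ n ∧ n ≤ (N : ℤ) ∧
                ∀ p : ℕ, Nat.Prime p → y ≤ (p : ℝ) → (p : ℝ) ≤ 2 * y →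
                  ∃ j : ℕ, (j : ℝ) ≤ (p : ℝ) ^ ((1 : ℝ)/2 - ε) ∧
                    (n : ZMod p) = (j : ZMod p)} →
        ∀ q : ℕ, Nat.Prime q → y ≤ (q : ℝ) → (q : ℝ) ≤ 2 * y →
          (∀ p : ℕ, Nat.Prime p → y ≤ (p : ℝ) → (p : ℝ) ≤ 2 * y → q ≤ p) →
          A = {n : ℤ | 0 ≤ n ∧ (n : ℝ) ≤ (q : ℝ) ^ ((1 : ℝ)/2 - ε)} := by
  intro ε hε
  obtain ⟨hε0, hε1⟩ := hε
  have htend : Filter.Tendsto (fun N : ℕ => Real.log N) Filter.atTop Filter.atTop :=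
    Real.tendsto_log_atTop.comp tendsto_natCast_atTop_atTop
  obtain ⟨M, hM⟩ := Filter.eventually_atTop.1
    ((tendsto_nat_floor_atTop (α := ℝ)).eventually eventually_div_four_le_log_prod_primes)
  obtain ⟨N₀, hN₀⟩ := Filter.eventually_atTop.1
    (htend.eventually (Filter.eventually_ge_atTop (max M 16)))
  refine ⟨N₀, fun N hN y hNy hyN A hA q hq hyq hqy hmin => ?_⟩
  have hlogM : max M 16 ≤ Real.log N := hN₀ N hN.le
  have hlog16 : 16 ≤ Real.log N := (le_max_right _ _).trans hlogM
  have hlogy : Real.log N ≤ y := by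
    refine le_trans ?_ hNy
    calc Real.log N ≤ (16 * Real.log N) ^ (1 : ℝ) := by rw [Real.rpow_one]; linarith
      _ ≤ _ := by
        refine Real.rpow_le_rpow_of_exponent_le (by linarith) ?_
        rw [le_div_iff₀ (by linarith)]
        linarith
  have hy16 : 16 ≤ y := hlog16.trans hlogy
  have hy : 16 * Real.log N ≤ y ^ (1 / 2 + ε) := by
    calc 16 * Real.log N = ((16 * Real.log N) ^ (1 / ((1 : ℝ) / 2 + ε))) ^ (1 / 2 + ε) := by
          rw [← Real.rpow_mul (by linarith), one_div_mul_cancel (by linarith), Real.rpow_one]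
      _ ≤ _ := Real.rpow_le_rpow (by positivity) hNy (by linarith)
  have hsmall : (2 * y) ^ (1 / 2 - ε) < y := by
    calc (2 * y) ^ (1 / 2 - ε) ≤ (2 * y) ^ (1 / 2 : ℝ) :=
          Real.rpow_le_rpow_of_exponent_le (by linarith) (by linarith)
      _ = √(2 * y) := (Real.sqrt_eq_rpow _).symm
      _ < y := by rw [Real.sqrt_lt' (by linarith)]; nlinarith
  have hqsmall : (q : ℝ) ^ (1 / 2 - ε) < y :=
    (Real.rpow_le_rpow (by positivity) hqy (by linarith)).trans_lt hsmall
  subst hA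
  ext a
  constructor
  · rintro ⟨ha0, haN, h⟩
    lift a to ℕ using ha0
    refine ⟨Int.natCast_nonneg a, ?_⟩
    have hay : (a : ℝ) < y := (le_rpow_of_small_residues ⟨hε0, hε1⟩ (by linarith) hy
      (hM y (((le_max_left _ _).trans hlogM).trans hlogy)) (by exact_mod_cast haN)
      (by simpa using h)).trans_lt hsmall
    obtain ⟨j, hj, hja⟩ := h q hq hyq hqy
    have haq : a < q := by exact_mod_cast hay.trans_le hyq
    have hjq : j < q := by exact_mod_cast (hj.trans_lt hqsmall).trans_le hyq
    have haj : a = j :=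
      ((ZMod.natCast_eq_natCast_iff _ _ _).1 (by simpa using hja)).eq_of_lt_of_lt haq hjq
    rw [haj]
    simpa using hj
  · rintro ⟨ha0, ha⟩
    lift a to ℕ using ha0
    rw [Int.cast_natCast] at ha
    refine ⟨Int.natCast_nonneg a, ?_, fun p hp hyp hpy => ⟨a, ha.trans ?_, by simp⟩⟩
    · exact_mod_cast ha.trans (hqsmall.le.trans hyN)
    · exact Real.rpow_le_rpow (by positivity) (by exact_mod_cast hmin p hp hyp hpy)
        (by linarith)
end

section
/- There exists an absolute constant c > 0 such that for each ε ∈ (0, 1/2) and all sufficiently large integers N the following holds: there exists a real number x with N^{−1/2−ε}/20 ≤ x ≤ N^{−1/2−ε}/10 such that the number of pairs (p, a), where p is a prime with N ≤ p ≤ 2N, a is an integer with 1 ≤ a ≤ p − 1, and a/p lies in the interval [x, x + N^{−1−2ε}/100], is at least c·N^{1−2ε}/log N. -/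
open Finset in
theorem centralBinom_le_mul_pow_card_primes (n : ℕ) (hn : 2 < n) :
    Nat.centralBinom n ≤
      (2 * n) ^ (#{p ∈ Icc n (2 * n) | p.Prime} + Nat.sqrt (2 * n)) * 4 ^ (2 * n / 3) := by
  have n2_pos : 1 ≤ 2 * n := by lia
  let f : ℕ → ℕ := fun p => p ^ n.centralBinom.factorization p
  have hf : ∀ p, f p ≤ 2 * n := fun p => Nat.pow_factorization_choose_le (by lia)
  have hprod : Nat.centralBinom n =
      (∏ p ∈ Icc n (2 * n) with p.Prime, f p) * ∏ p ∈ range (2 * n / 3 + 1) with p.Prime, f p := by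
    rw [← n.prod_pow_factorization_centralBinom, ← prod_union]
    · refine (prod_subset ?_ ?_).symm
      · intro p hp
        simp only [mem_union, mem_filter, mem_Icc, mem_range] at hp ⊢
        lia
      · intro p hp h
        simp only [mem_union, mem_filter, mem_Icc, mem_range] at hp h
        by_cases hpp : p.Prime
        · rw [Nat.factorization_centralBinom_of_two_mul_self_lt_three_mul hn
            (by grind) (by grind), pow_zero]
        · rw [Nat.factorization_eq_zero_of_not_prime _ hpp, pow_zero]
    · refine disjoint_left.mpr fun p hp h => ?_
      simp only [mem_filter, mem_Icc, mem_range] at hp h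
      lia
  rw [hprod, pow_add, mul_assoc]
  refine mul_le_mul' (prod_le_pow_card _ _ _ fun p _ => hf p) ?_
  rw [← prod_filter_mul_prod_filter_not _ (· ≤ Nat.sqrt (2 * n))]
  refine mul_le_mul' ((prod_le_pow_card _ _ _ fun p _ => hf p).trans ?_) ?_
  · refine pow_right_mono₀ n2_pos ?_
    calc _ ≤ #(Icc 1 (Nat.sqrt (2 * n))) := card_le_card fun p hp => by
          simp only [mem_filter, mem_Icc] at hp ⊢
          exact ⟨hp.1.2.one_lt.le, hp.2⟩
      _ = _ := by simp
  · refine le_trans ?_ (primorial_le_four_pow (2 * n / 3))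
    refine (prod_le_prod' fun p hp => (?_ : f p ≤ p)).trans ?_
    · obtain ⟨h1, h2⟩ := mem_filter.1 hp
      refine (pow_right_mono₀ (mem_filter.1 h1).2.one_lt.le ?_).trans (pow_one p).le
      exact Nat.factorization_choose_le_one (Nat.sqrt_lt'.mp <| not_le.1 h2)
    · refine prod_le_prod_of_subset_of_one_le' (filter_subset _ _) ?_
      exact fun p hp _ => (mem_filter.1 hp).2.one_lt.le

open Finset Filter in
/-- A lower bound of Chebyshev type for the number of primes in a dyadic interval. -/
theorem eventually_div_log_le_card_primes_Icc :
    ∀ᶠ n : ℕ in atTop,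
      (n : ℝ) / (10 * Real.log n) ≤ (#{p ∈ Icc n (2 * n) | p.Prime} : ℝ) := by
  have hlog := ((isLittleO_log_rpow_atTop (r := 1 / 2) (by norm_num)).bound
    (c := 1 / 100) (by norm_num)).natCast_atTop
  filter_upwards [hlog, eventually_ge_atTop 4] with n hlog hn
  set P := #{p ∈ Icc n (2 * n) | p.Prime}
  have hn' : (4 : ℝ) ≤ n := by exact_mod_cast hn
  have hn0 : (0 : ℝ) < n := by linarith
  have hL : 0 < Real.log n := Real.log_pos (by linarith)
  rw [← Real.sqrt_eq_rpow, Real.norm_of_nonneg hL.le, Real.norm_of_nonneg (by positivity)] at hlog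
  have hmain : (4 : ℝ) ^ n ≤ n * ((2 * n) ^ (P + Nat.sqrt (2 * n)) * 4 ^ (2 * n / 3)) := by
    exact_mod_cast (Nat.four_pow_lt_mul_centralBinom n hn).le.trans
      (Nat.mul_le_mul_left n (centralBinom_le_mul_pow_card_primes n (by lia)))
  have h2 := Real.log_le_log (by positivity) hmain
  rw [Real.log_mul (by positivity) (by positivity), Real.log_mul (by positivity) (by positivity),
    Real.log_pow, Real.log_pow, Real.log_pow] at h2
  push_cast at h2
  have hdiv : ((2 * n / 3 : ℕ) : ℝ) ≤ 2 * n / 3 := by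
    exact_mod_cast Nat.cast_div_le (α := ℝ) (m := 2 * n) (n := 3)
  have hlog4 : (1 : ℝ) ≤ Real.log 4 := by
    rw [show (4 : ℝ) = 2 ^ 2 by norm_num, Real.log_pow]
    have := Real.log_two_gt_d9
    push_cast
    linarith
  have hlog2n : Real.log (2 * n) ≤ 2 * Real.log n := by
    rw [Real.log_mul (by norm_num) (by positivity)]
    have := Real.log_le_log (by norm_num) (show (2 : ℝ) ≤ n by linarith)
    linarith
  have hsqrt : (Nat.sqrt (2 * n) : ℝ) ≤ 2 * √(n : ℝ) := by
    refine Real.nat_sqrt_le_real_sqrt.trans ?_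
    rw [Real.sqrt_le_left (by positivity), mul_pow, Real.sq_sqrt hn0.le]
    push_cast
    linarith
  have hss : √(n : ℝ) * √(n : ℝ) = n := Real.mul_self_sqrt hn0.le
  have hs1 : 1 ≤ √(n : ℝ) := Real.one_le_sqrt.mpr (by linarith)
  have hPs : ((P : ℝ) + Nat.sqrt (2 * n)) * Real.log (2 * n)
      ≤ (P + 2 * √(n : ℝ)) * (2 * Real.log n) := by
    have : 0 ≤ Real.log (2 * n) := Real.log_nonneg (by linarith)
    gcongr
  have hsl : √(n : ℝ) * Real.log n ≤ 1 / 100 * n := by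
    calc _ ≤ √(n : ℝ) * (1 / 100 * √(n : ℝ)) := by gcongr
      _ = 1 / 100 * (√(n : ℝ) * √(n : ℝ)) := by ring
      _ = _ := by rw [hss]
  have hl : Real.log n ≤ √(n : ℝ) * Real.log n := le_mul_of_one_le_left hL.le hs1
  have h4 : ((2 * n / 3 : ℕ) : ℝ) * Real.log 4 ≤ 2 * n / 3 * Real.log 4 := by gcongr
  have h5 : (n : ℝ) ≤ n * Real.log 4 := le_mul_of_one_le_right hn0.le hlog4
  rw [div_le_iff₀ (by positivity)]
  nlinarith

open Finset in
/-- Averaging over `⌊5 / r⌋₊ + 1` translates of an interval of length `r ^ 2 / 100`. -/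
theorem exists_card_mul_le_ncard_fractions (N : ℕ) (r : ℝ) (hr0 : 0 < r) (hr1 : r ≤ 1)
    (hNr : 40 ≤ N * r) :
    ∃ x : ℝ, r / 20 ≤ x ∧ x ≤ r / 10 ∧
      (#{p ∈ Icc N (2 * N) | p.Prime} : ℝ) * (N * r ^ 2 / 240) ≤
        ({q : ℕ × ℕ | Nat.Prime q.1 ∧ N ≤ q.1 ∧ q.1 ≤ 2 * N ∧ 1 ≤ q.2 ∧ q.2 ≤ q.1 - 1 ∧
          x ≤ (q.2 : ℝ) / (q.1 : ℝ) ∧ (q.2 : ℝ) / (q.1 : ℝ) ≤ x + r ^ 2 / 100} :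
            Set (ℕ × ℕ)).ncard := by
  set Q := {p ∈ Icc N (2 * N) | p.Prime}
  let S : Finset (Σ _ : ℕ, ℕ) := Q.sigma fun p => Icc ⌈p * r / 20⌉₊ ⌊p * r / 10⌋₊
  let g : (Σ _ : ℕ, ℕ) → ℕ := fun s => ⌊((s.2 : ℝ) / s.1 - r / 20) / (r ^ 2 / 100)⌋₊
  have hS : ∀ s ∈ S, s.1.Prime ∧ N ≤ s.1 ∧ s.1 ≤ 2 * N ∧
      r / 20 ≤ (s.2 : ℝ) / s.1 ∧ (s.2 : ℝ) / s.1 ≤ r / 10 := by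
    intro s hs
    simp only [S, Q, mem_sigma, mem_filter, mem_Icc, Nat.ceil_le] at hs
    obtain ⟨⟨⟨h1, h2⟩, h3⟩, h4, h5⟩ := hs
    have h6 := (Nat.le_floor_iff (by positivity)).mp h5
    have hp : (0 : ℝ) < s.1 := by exact_mod_cast h3.pos
    refine ⟨h3, h1, h2, ?_, ?_⟩
    · rw [le_div_iff₀ hp]; linarith
    · rw [div_le_iff₀ hp]; linarith
  have hScard : (#Q : ℝ) * (N * r / 40) ≤ #S := by
    rw [card_sigma, Nat.cast_sum, ← nsmul_eq_mul]
    refine card_nsmul_le_sum _ _ _ fun p hp => ?_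
    simp only [Q, mem_filter, mem_Icc] at hp
    have hpN : (N : ℝ) ≤ p := by exact_mod_cast hp.1.1
    rw [Nat.card_Icc]
    have h1 := Nat.lt_floor_add_one (p * r / 10 : ℝ)
    have h2 := Nat.ceil_lt_add_one (show 0 ≤ (p * r / 20 : ℝ) by positivity)
    have h3 : ((⌊p * r / 10⌋₊ + 1 : ℕ) : ℝ) - (⌈p * r / 20⌉₊ : ℕ) ≤
        ((⌊p * r / 10⌋₊ + 1 - ⌈p * r / 20⌉₊ : ℕ) : ℝ) := by
      rw [sub_le_iff_le_add]
      exact_mod_cast (by lia)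
    push_cast at h3
    have h4 : N * r ≤ p * r := by gcongr
    linarith
  have hg : ∀ s ∈ S, g s ∈ range (⌊5 / r⌋₊ + 1) := by
    intro s hs
    rw [mem_range, Nat.lt_succ_iff]
    refine Nat.floor_le_floor ?_
    rw [div_le_div_iff₀ (by positivity) hr0]
    nlinarith [(hS s hs).2.2.2.2]
  obtain ⟨j, hj, hcard⟩ := exists_le_card_fiber_of_nsmul_le_card_of_maps_to
    (b := (#Q : ℝ) * (N * r ^ 2 / 240)) hg (by simp) (by
      rw [card_range, nsmul_eq_mul]
      refine le_trans ?_ hScard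
      have h1 : ((⌊5 / r⌋₊ + 1 : ℕ) : ℝ) * r ≤ 6 := by
        have := Nat.floor_le (show 0 ≤ 5 / r by positivity)
        rw [le_div_iff₀ hr0] at this
        push_cast
        linarith
      calc _ = (((⌊5 / r⌋₊ + 1 : ℕ) : ℝ) * r) * (#Q * (N * r / 240)) := by ring
        _ ≤ 6 * (#Q * (N * r / 240)) := by gcongr
        _ = _ := by ring)
  have hj5 : (j : ℝ) * r ≤ 5 := by
    have h1 : (j : ℝ) ≤ ⌊5 / r⌋₊ := by exact_mod_cast Nat.lt_succ_iff.mp (mem_range.mp hj)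
    exact (le_div_iff₀ hr0).mp (h1.trans (Nat.floor_le (by positivity)))
  refine ⟨r / 20 + j * (r ^ 2 / 100), ?_, ?_, hcard.trans ?_⟩
  · have : 0 ≤ j * (r ^ 2 / 100) := by positivity
    linarith
  · nlinarith
  have hinj : Function.Injective fun s : (Σ _ : ℕ, ℕ) => (s.1, s.2) := by
    rintro ⟨a, b⟩ ⟨c, d⟩ h
    simpa using h
  rw [← card_image_of_injective _ hinj, Nat.cast_le, ← Set.ncard_coe_finset]
  refine Set.ncard_le_ncard ?_ ?_
  · intro q hq
    simp only [coe_image, coe_filter, Set.mem_image, Set.mem_ofPred_eq] at hq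
    obtain ⟨s, ⟨hs, hgs⟩, rfl⟩ := hq
    obtain ⟨h1, h2, h3, h4, h5⟩ := hS s hs
    have hp : (0 : ℝ) < s.1 := by exact_mod_cast h1.pos
    have h6 := (Nat.floor_eq_iff (div_nonneg (by linarith) (by positivity))).mp hgs
    rw [le_div_iff₀ (by positivity), div_lt_iff₀ (by positivity)] at h6
    have h7 : (0 : ℝ) < s.2 := by
      by_contra! h
      have := div_nonpos_of_nonpos_of_nonneg h hp.le
      linarith
    have h8 : (s.2 : ℝ) < s.1 := by
      rw [← div_lt_one hp]
      linarith
    have h9 : s.2 < s.1 := by exact_mod_cast h8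
    refine ⟨h1, h2, h3, by exact_mod_cast h7, by lia, ?_, ?_⟩ <;> dsimp only <;> linarith
  · refine ((Set.finite_Iic (2 * N)).prod (Set.finite_Iic (2 * N))).subset fun q hq => ?_
    obtain ⟨-, -, h3, -, h5, -⟩ := hq
    exact ⟨h3, by simp only [Set.mem_Iic]; lia⟩

theorem stmt19 :
    ∃ c : ℝ, 0 < c ∧ ∀ ε : ℝ, ε ∈ Set.Ioo (0 : ℝ) (1/2) → ∃ N₀ : ℕ,
      ∀ N : ℕ, N₀ ≤ N →
        ∃ x : ℝ, (N : ℝ) ^ (-(1 : ℝ)/2 - ε) / 20 ≤ x ∧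
          x ≤ (N : ℝ) ^ (-(1 : ℝ)/2 - ε) / 10 ∧
          c * (N : ℝ) ^ (1 - 2 * ε) / Real.log N ≤
            (({q : ℕ × ℕ | Nat.Prime q.1 ∧ N ≤ q.1 ∧ q.1 ≤ 2 * N ∧
                1 ≤ q.2 ∧ q.2 ≤ q.1 - 1 ∧
                x ≤ (q.2 : ℝ) / (q.1 : ℝ) ∧
                (q.2 : ℝ) / (q.1 : ℝ) ≤ x + (N : ℝ) ^ (-(1 : ℝ) - 2 * ε) / 100} :
              Set (ℕ × ℕ)).ncard : ℝ) := by
  refine ⟨1 / 2400, by norm_num, fun ε hε => ?_⟩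
  rw [← Filter.eventually_atTop]
  have hgrow := ((tendsto_rpow_atTop (show 0 < 1 / 2 - ε by linarith [hε.2])).eventually_ge_atTop
    40).natCast_atTop
  filter_upwards [eventually_div_log_le_card_primes_Icc, hgrow, Filter.eventually_ge_atTop 2]
    with N hprimes hgrow hN
  have hN1 : (1 : ℝ) < N := by exact_mod_cast hN
  have hN0 : (0 : ℝ) < N := by linarith
  have hNr : 40 ≤ N * (N : ℝ) ^ (-(1 : ℝ) / 2 - ε) := by
    rw [← Real.rpow_one_add' hN0.le (by linarith [hε.2])]
    convert! hgrow using 2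
    ring
  have hsq : ((N : ℝ) ^ (-(1 : ℝ) / 2 - ε)) ^ 2 = (N : ℝ) ^ (-(1 : ℝ) - 2 * ε) := by
    rw [← Real.rpow_mul_natCast hN0.le]
    congr 1
    push_cast
    ring
  obtain ⟨x, h1, h2, h3⟩ := exists_card_mul_le_ncard_fractions N ((N : ℝ) ^ (-(1 : ℝ) / 2 - ε))
    (by positivity) (Real.rpow_le_one_of_one_le_of_nonpos hN1.le (by linarith [hε.1])) hNr
  rw [hsq] at h3
  refine ⟨x, h1, h2, le_trans ?_ h3⟩
  have hpow : (N : ℝ) ^ (1 - 2 * ε) = N * (N * (N : ℝ) ^ (-(1 : ℝ) - 2 * ε)) := by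
    rw [← mul_assoc, ← sq, ← Real.rpow_natCast, ← Real.rpow_add hN0]
    congr 1
    push_cast
    ring
  calc _ = (N : ℝ) / (10 * Real.log N) * (N * (N : ℝ) ^ (-(1 : ℝ) - 2 * ε) / 240) := by
        rw [hpow]; ring
    _ ≤ _ := by gcongr
end
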